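/- Let (x(t),v(t)) : [0,∞) → ℝ² solve the planar system ẋ = v, v̇ = −v/(1 + x²) with x(0) = x_0 and v(0) = v_0 > 0. Then v(t) = v_0 + arctan(x_0) − arctan(x(t)) for all t ≥ 0. Moreover, if arctan(x_0) + v_0 ≥ π/2 + ε for some ε > 0, then v(t) > ε for every t ≥ 0; in particular v(t) does not converge to 0, i.e., the two-agent Cucker–Smale system does not tend to consensus. -/

import Mathlib

/-- Two agents on the line (Cucker–Smale with `a(r) = 2/(1+r²)`, relative coordinates):
`ẋ = v`, `v̇ = −v/(1+x²)`, `v(0) > 0`.  Then `v(t) = v₀ + arctan x₀ − arctan x(t)`, and if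
`arctan x₀ + v₀ ≥ π/2 + ε` for some `ε > 0` then `v(t) > ε` for all `t ≥ 0`; in particular
`v` does not converge to `0`, i.e. there is no consensus. -/
theorem cuckerSmale_two_agents_no_consensus (x v : ℝ → ℝ)
    (hx : ∀ t, 0 ≤ t → HasDerivAt x (v t) t)
    (hv : ∀ t, 0 ≤ t → HasDerivAt v (-(v t) / (1 + (x t) ^ 2)) t)
    (hv0 : 0 < v 0) :
    (∀ t, 0 ≤ t → v t = v 0 + Real.arctan (x 0) - Real.arctan (x t)) ∧
    (∀ ε > (0 : ℝ), Real.arctan (x 0) + v 0 ≥ Real.pi / 2 + ε →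
      (∀ t, 0 ≤ t → ε < v t) ∧
      ¬ Filter.Tendsto v Filter.atTop (nhds 0)) := by
  have hconst : ∀ t, 0 ≤ t → v t = v 0 + Real.arctan (x 0) - Real.arctan (x t) := by
    intro t ht
    have hd : ∀ s, 0 ≤ s → HasDerivAt (fun s => v s + Real.arctan (x s)) 0 s := by
      intro s hs
      exact ((hv s hs).add (hx s hs).arctan).congr_deriv (by ring)
    have h := constant_of_has_deriv_right_zero (a := 0) (b := t)
      (fun s hs => (hd s hs.1).continuousAt.continuousWithinAt)
      (fun s hs => (hd s hs.1).hasDerivWithinAt) t ⟨ht, le_rfl⟩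
    linarith
  refine ⟨hconst, fun ε hε h => ?_⟩
  have hlow : ∀ t, 0 ≤ t → ε < v t := by
    intro t ht
    have := hconst t ht
    have := Real.arctan_lt_pi_div_two (x t)
    linarith
  refine ⟨hlow, fun hlim => hε.not_ge (ge_of_tendsto hlim ?_)⟩
  filter_upwards [Filter.eventually_ge_atTop 0] with t ht using (hlow t ht).le
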